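/- arXiv:1506.01339 — 3 statements merged into one kernel-verified Lean document; each statement's English description precedes it below -/
import Mathlib

section
/- Let y_1,…,y_n ∈ {0,1} be ground-truth labels with n0 = #{i : y_i = 0} ≥ 1 and n1 = #{i : y_i = 1} ≥ 1, and let the real-valued guesses ŷ_1,…,ŷ_n be strictly increasing (ŷ_1 < ŷ_2 < … < ŷ_n). Let k ≤ n1 be a positive integer, and suppose exactly m of the last k examples are negatively labeled (m = #{i > n−k : y_i = 0}) with m ≥ 1. Then at least m·(n1 − k) of the n0·n1 positive–negative pairs are misclassified by the guesses, and consequently the AUC satisfies f(y_{1:n}, ŷ_{1:n}) ≤ 1 − m·(n1 − k)/(n0·n1) ≤ 1 − 1/n0 + k/(n0·n1). -/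
open Finset

/-- AUC of real-valued guesses `g` against binary labels `y` (`false` = 0, `true` = 1):
`(1/(n0*n1)) * Σ_{i : y i = 0} Σ_{j : y j = 1} 1[g i < g j]`. -/
noncomputable def auc {n : ℕ} (y : Fin n → Bool) (g : Fin n → ℝ) : ℝ :=
  (∑ i ∈ Finset.univ.filter fun i => y i = false,
      ∑ j ∈ Finset.univ.filter fun j => y j = true,
        if g i < g j then (1 : ℝ) else 0) /
    (((Finset.univ.filter fun i : Fin n => y i = false).card : ℝ) *
      ((Finset.univ.filter fun j : Fin n => y j = true).card : ℝ))

/-- The AUC is one minus the fraction of misclassified positive–negative pairs. -/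
theorem auc_eq_one_sub {n : ℕ} (y : Fin n → Bool) (g : Fin n → ℝ)
    (hg : Function.Injective g)
    (h0 : (Finset.univ.filter fun i => y i = false).card ≠ 0)
    (h1 : (Finset.univ.filter fun i => y i = true).card ≠ 0) :
    auc y g = 1 - ((Finset.univ.filter fun p : Fin n × Fin n =>
          y p.1 = true ∧ y p.2 = false ∧ g p.1 < g p.2).card : ℝ) /
      (((Finset.univ.filter fun i => y i = false).card : ℝ) *
        ((Finset.univ.filter fun i => y i = true).card : ℝ)) := by
  have hmis : ((Finset.univ.filter fun p : Fin n × Fin n =>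
        y p.1 = true ∧ y p.2 = false ∧ g p.1 < g p.2).card : ℝ) =
      ∑ i ∈ Finset.univ.filter fun i => y i = false,
        ∑ j ∈ Finset.univ.filter fun j => y j = true, if g j < g i then (1 : ℝ) else 0 := by
    rw [Finset.sum_comm, ← Finset.sum_product', Finset.sum_boole]
    congr 2
    ext p
    simp [and_assoc]
  have hsum : (∑ i ∈ Finset.univ.filter fun i => y i = false,
        ∑ j ∈ Finset.univ.filter fun j => y j = true, if g i < g j then (1 : ℝ) else 0) +
      (∑ i ∈ Finset.univ.filter fun i => y i = false,
        ∑ j ∈ Finset.univ.filter fun j => y j = true, if g j < g i then (1 : ℝ) else 0) =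
      ((Finset.univ.filter fun i => y i = false).card : ℝ) *
        ((Finset.univ.filter fun i => y i = true).card : ℝ) := by
    have hpair : ∀ i ∈ Finset.univ.filter (fun i => y i = false),
        ∀ j ∈ Finset.univ.filter (fun j => y j = true),
        ((if g i < g j then (1 : ℝ) else 0) + if g j < g i then (1 : ℝ) else 0) = 1 := by
      intro i hi j hj
      have hij : i ≠ j := by
        rintro rfl
        simp_all
      rcases lt_or_gt_of_ne (hg.ne hij) with h | h <;> simp [h, h.not_gt]
    rw [← Finset.sum_add_distrib]
    simp_rw [← Finset.sum_add_distrib]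
    rw [Finset.sum_congr rfl fun i hi => Finset.sum_congr rfl (hpair i hi)]
    simp
  rw [auc, hmis, eq_sub_iff_add_eq, ← add_div, hsum, div_self]
  positivity

/-- At most `k` elements of `Fin n` are among the last `k`. -/
theorem card_filter_sub_le_val_le (n k : ℕ) :
    (Finset.univ.filter fun i : Fin n => n - k ≤ (i : ℕ)).card ≤ k := by
  calc (Finset.univ.filter fun i : Fin n => n - k ≤ (i : ℕ)).card
      ≤ (Finset.Ico (n - k) n).card :=
        Finset.card_le_card_of_injOn Fin.val (by intro i hi; simp_all)
          Fin.val_injective.injOn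
    _ ≤ k := by simp; omega

/-- Every negative among the last `k` examples forms a misclassified pair with every positive
outside the last `k`. -/
theorem mul_sub_le_card_misclassified {n : ℕ} (y : Fin n → Bool) (g : Fin n → ℝ)
    (hg : StrictMono g) (k : ℕ) :
    (Finset.univ.filter fun i : Fin n => n - k ≤ (i : ℕ) ∧ y i = false).card *
        ((Finset.univ.filter fun i => y i = true).card - k) ≤
      (Finset.univ.filter fun p : Fin n × Fin n =>
          y p.1 = true ∧ y p.2 = false ∧ g p.1 < g p.2).card := by
  have hpos : (Finset.univ.filter fun i => y i = true).card - k ≤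
      ((Finset.univ.filter fun i => y i = true) \
        Finset.univ.filter fun i : Fin n => n - k ≤ (i : ℕ)).card :=
    (Nat.sub_le_sub_left (card_filter_sub_le_val_le n k) _).trans (Finset.le_card_sdiff _ _)
  rw [mul_comm]
  refine (Nat.mul_le_mul_right _ hpos).trans ?_
  rw [← Finset.card_product]
  refine Finset.card_le_card fun p hp => ?_
  simp only [Finset.mem_product, Finset.mem_sdiff, Finset.mem_filter, Finset.mem_univ,
    true_and, not_le] at hp ⊢
  exact ⟨hp.1.1, hp.2.2, hg (Fin.lt_def.2 (hp.1.2.trans_le hp.2.1))⟩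

/-- If exactly `m ≥ 1` of the last `k ≤ n1` examples (in the rank order of strictly
increasing guesses) are negatively labeled, then at least `m*(n1-k)` positive–negative
pairs are misclassified, and hence
`AUC ≤ 1 - m*(n1-k)/(n0*n1) ≤ 1 - 1/n0 + k/(n0*n1)`. -/
theorem stmt3 {n : ℕ} (y : Fin n → Bool) (g : Fin n → ℝ) (hg : StrictMono g)
    (n0 n1 : ℕ)
    (hn0 : n0 = (Finset.univ.filter fun i => y i = false).card)
    (hn1 : n1 = (Finset.univ.filter fun i => y i = true).card)
    (hn0pos : 1 ≤ n0) (hn1pos : 1 ≤ n1)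
    (k : ℕ) (hk1 : 1 ≤ k) (hkn1 : k ≤ n1)
    (m : ℕ)
    (hm : m = (Finset.univ.filter fun i : Fin n => n - k ≤ (i : ℕ) ∧ y i = false).card)
    (hm1 : 1 ≤ m) :
    m * (n1 - k) ≤
      (Finset.univ.filter fun p : Fin n × Fin n =>
          y p.1 = true ∧ y p.2 = false ∧ g p.1 < g p.2).card ∧
    auc y g ≤ 1 - ((m : ℝ) * ((n1 : ℝ) - (k : ℝ))) / ((n0 : ℝ) * (n1 : ℝ)) ∧
    auc y g ≤ 1 - 1 / (n0 : ℝ) + (k : ℝ) / ((n0 : ℝ) * (n1 : ℝ)) := by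
  have hmis := mul_sub_le_card_misclassified y g hg k
  rw [← hm, ← hn1] at hmis
  have hauc := auc_eq_one_sub y g hg.injective (by omega) (by omega)
  rw [← hn0, ← hn1] at hauc
  have h0 : (0 : ℝ) < n0 := by exact_mod_cast hn0pos
  have h1 : (0 : ℝ) < n1 := by exact_mod_cast hn1pos
  have hk : (k : ℝ) ≤ n1 := by exact_mod_cast hkn1
  have hm' : (1 : ℝ) ≤ m := by exact_mod_cast hm1
  have hbound : auc y g ≤ 1 - ((m : ℝ) * ((n1 : ℝ) - (k : ℝ))) / ((n0 : ℝ) * (n1 : ℝ)) := by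
    rw [hauc, ← Nat.cast_sub hkn1]
    gcongr
    exact_mod_cast hmis
  refine ⟨hmis, hbound, hbound.trans ?_⟩
  have hle : ((n1 : ℝ) - k) / (n0 * n1) ≤ (m * ((n1 : ℝ) - k)) / (n0 * n1) := by
    gcongr
    exact le_mul_of_one_le_left (sub_nonneg.2 hk) hm'
  have hsplit : ((n1 : ℝ) - k) / (n0 * n1) = 1 / n0 - k / (n0 * n1) := by
    field_simp
  linarith
end

section
/- Let p, q be positive integers with 2p < q (so 0 < p/q < 1/2), let n = 4q, and let ŷ_1,…,ŷ_n be any pairwise-distinct real-valued guesses. Then the number of distinct binary labelings (y_1,…,y_n) ∈ {0,1}^n for which f(y_{1:n}, ŷ_{1:n}) = p/q is at least ((q + 2p)/q)^q = (1 + 2p/q)^{n/4}. -/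
open Finset

/-- The rank of a point of `Fin r ⊕ (Fin m ⊕ Fin m)`: first the points of `Fin r`, then two copies
of `Fin m`, the second one in reverse order. -/
def mirrorRank (r m : ℕ) : Fin r ⊕ (Fin m ⊕ Fin m) → ℕ
  | .inl a => a
  | .inr (.inl i) => r + i
  | .inr (.inr i) => r + 2 * m - 1 - i

lemma mirrorRank_lt (r m : ℕ) (x : Fin r ⊕ (Fin m ⊕ Fin m)) : mirrorRank r m x < r + 2 * m := by
  rcases x with a | i | i <;> simp only [mirrorRank] <;> omega

lemma mirrorRank_injective (r m : ℕ) : Function.Injective (mirrorRank r m) := by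
  rintro (a | a | a) (b | b | b) h <;>
    simp only [mirrorRank, Sum.inl.injEq, Sum.inr.injEq, reduceCtorEq, Fin.ext_iff] at h ⊢ <;> omega

/-- The enumeration of `Fin n` by `mirrorRank`. -/
noncomputable def mirrorEquiv {r m n : ℕ} (h : r + 2 * m = n) :
    Fin r ⊕ (Fin m ⊕ Fin m) ≃ Fin n :=
  Equiv.ofBijective (fun x => ⟨mirrorRank r m x, h ▸ mirrorRank_lt r m x⟩)
    ((Fintype.bijective_iff_injective_and_card _).2
      ⟨fun x y hxy => mirrorRank_injective r m (Fin.ext_iff.1 hxy), by simp; omega⟩)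

/-- Label every point of `Fin r` by `true`, and label both copies of `Fin m` by membership
in `S`. -/
def mirrorLabel (r : ℕ) {m : ℕ} (S : Finset (Fin m)) : Fin r ⊕ (Fin m ⊕ Fin m) → Bool
  | .inl _ => true
  | .inr (.inl i) => decide (i ∈ S)
  | .inr (.inr i) => decide (i ∈ S)

lemma mirrorLabel_injective (r m : ℕ) :
    Function.Injective (mirrorLabel r : Finset (Fin m) → _) := by
  intro S T h
  ext i
  simpa [mirrorLabel] using congrFun h (.inr (.inl i))

lemma card_mirrorLabel_inr_true (r : ℕ) {m : ℕ} (S : Finset (Fin m)) :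
    #{x | mirrorLabel r S (.inr x) = true} = 2 * #S := by
  rw [card_filter, Fintype.sum_sum_type]
  simp [mirrorLabel, two_mul]

lemma card_mirrorLabel_inr_false (r : ℕ) {m : ℕ} (S : Finset (Fin m)) :
    #{x | mirrorLabel r S (.inr x) = false} = 2 * (m - #S) := by
  have h : #{x | x ∉ S} = m - #S := by simp [filter_not, ← compl_eq_univ_sdiff, card_compl]
  rw [card_filter, Fintype.sum_sum_type, ← h, card_filter]
  simp only [mirrorLabel, decide_eq_false_iff_not, two_mul]

lemma card_mirrorLabel_true (r : ℕ) {m : ℕ} (S : Finset (Fin m)) :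
    #{x | mirrorLabel r S x = true} = r + 2 * #S := by
  rw [card_filter, Fintype.sum_sum_type, ← card_filter, ← card_filter, card_mirrorLabel_inr_true]
  simp [mirrorLabel]

lemma card_mirrorLabel_false (r : ℕ) {m : ℕ} (S : Finset (Fin m)) :
    #{x | mirrorLabel r S x = false} = 2 * (m - #S) := by
  rw [card_filter, Fintype.sum_sum_type, ← card_filter, ← card_filter, card_mirrorLabel_inr_false]
  simp [mirrorLabel]

/-- The number of correctly ordered pairs of a mirror-symmetric labeling is half the number of
pairs from the symmetric part. -/
lemma sum_mirrorLabel (r : ℕ) {m : ℕ} (S : Finset (Fin m)) :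
    ∑ x with mirrorLabel r S x = false, ∑ y with mirrorLabel r S y = true,
      (if mirrorRank r m x < mirrorRank r m y then 1 else 0) = 2 * (m - #S) * #S := by
  set u : Fin m ⊕ Fin m → Bool := fun x => mirrorLabel r S (.inr x) with hu
  set k : Fin m ⊕ Fin m → ℕ := fun x => mirrorRank r m (.inr x) with hk
  have hu_swap (x) : u x.swap = u x := by rcases x with i | i <;> rfl
  have hk_swap (x y) : k x.swap < k y.swap ↔ k y < k x := by
    rcases x with i | i <;> rcases y with j | j <;>
      simp only [hk, mirrorRank, Sum.swap_inl, Sum.swap_inr] <;> omega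
  have hlow (x : Fin m ⊕ Fin m) (a : Fin r) :
      ¬ mirrorRank r m (.inr x) < mirrorRank r m (.inl a) := by
    rcases x with i | i <;> simp only [mirrorRank] <;> omega
  set A := ∑ x with u x = false, ∑ y with u y = true, (if k x < k y then 1 else 0) with hA
  have hleft : ∑ x with mirrorLabel r S x = false, ∑ y with mirrorLabel r S y = true,
      (if mirrorRank r m x < mirrorRank r m y then 1 else 0) = A := by
    simp only [hA, sum_filter, Fintype.sum_sum_type (α₁ := Fin r), hlow]
    simp [mirrorLabel, hu, hk]
  have hswap : A = ∑ x with u x = false, ∑ y with u y = true, (if k y < k x then 1 else 0) := by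
    simp only [hA, sum_filter]
    rw [← (Equiv.sumComm _ _).sum_comp]
    refine sum_congr rfl fun x _ => ?_
    rw [← (Equiv.sumComm _ _).sum_comp]
    simp only [Equiv.sumComm_apply, hu_swap, hk_swap]
  have hadd : A + A = #{x | u x = false} * #{x | u x = true} := by
    nth_rewrite 2 [hswap]
    simp only [hA, ← sum_add_distrib]
    rw [← smul_eq_mul, ← sum_const, sum_congr rfl]
    intro x hx
    rw [card_eq_sum_ones, sum_congr rfl]
    intro y hy
    have hne : k x ≠ k y := fun h => by
      have : x = y := Sum.inr_injective (mirrorRank_injective r m h)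
      simp_all
    rcases hne.lt_or_gt with h | h <;> simp [h, h.le]
  rw [hleft]
  rw [card_mirrorLabel_inr_true, card_mirrorLabel_inr_false] at hadd
  linarith

lemma auc_mirrorLabel {n r m : ℕ} (e : Fin r ⊕ (Fin m ⊕ Fin m) ≃ Fin n) (g : Fin n → ℝ)
    (he : ∀ x y, g (e x) < g (e y) ↔ mirrorRank r m x < mirrorRank r m y) (S : Finset (Fin m)) :
    auc (mirrorLabel r S ∘ e.symm) g =
      (2 * (m - #S) * #S : ℕ) / ((2 * (m - #S) : ℕ) * (r + 2 * #S : ℕ)) := by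
  have hcard (b : Bool) :
      #{i | (mirrorLabel r S ∘ e.symm) i = b} = #{x | mirrorLabel r S x = b} := by
    simp only [card_filter]
    rw [← e.sum_comp]
    simp
  rw [auc, hcard, hcard, card_mirrorLabel_true, card_mirrorLabel_false, ← sum_mirrorLabel r S]
  congr 1
  push_cast
  simp only [sum_filter]
  rw [← e.sum_comp]
  refine sum_congr rfl fun x _ => ?_
  rw [← e.sum_comp]
  simp [he]

lemma one_add_div_pow_le_choose (k a : ℕ) {j : ℕ} (hj : j ≤ k) :
    (1 + (a : ℝ) / k) ^ j ≤ ((j + a).choose j : ℝ) := by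
  induction j with
  | zero => simp
  | succ j ih =>
    have hchoose : ((j + 1 + a).choose (j + 1) : ℝ) =
        (j + a).choose j * (1 + (a : ℝ) / (j + 1 : ℕ)) := by
      have h : (((j + a + 1) * (j + a).choose j : ℕ) : ℝ) =
          ((j + a + 1).choose (j + 1) * (j + 1) : ℕ) :=
        congrArg _ (Nat.add_one_mul_choose_eq (j + a) j)
      rw [add_right_comm]
      push_cast at h ⊢
      field_simp
      linarith
    rw [pow_succ, hchoose]
    gcongr
    exact ih (by omega)

/-- Case `0 < p/q < 1/2`: for any injective guesses on `n = 4q` examples, the number of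
binary labelings (with both classes nonempty) achieving AUC exactly `p/q` is at least
`((q + 2p)/q)^q = (1 + 2p/q)^(n/4)`. -/
theorem stmt7 (p q : ℕ) (hp : 0 < p) (h2pq : 2 * p < q)
    (g : Fin (4 * q) → ℝ) (hg : Function.Injective g) :
    (((q : ℝ) + 2 * (p : ℝ)) / (q : ℝ)) ^ q ≤
      (Nat.card {y : Fin (4 * q) → Bool //
        (∃ i, y i = false) ∧ (∃ i, y i = true) ∧ auc y g = (p : ℝ) / (q : ℝ)} : ℝ) := by
  set r := 2 * q - 4 * p with hr
  set m := q + 2 * p with hm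
  let e : Fin r ⊕ (Fin m ⊕ Fin m) ≃ Fin (4 * q) :=
    (mirrorEquiv (by omega)).trans (Tuple.sort g)
  have hmono : StrictMono (g ∘ Tuple.sort g) :=
    (Tuple.monotone_sort g).strictMono_of_injective (hg.comp (Tuple.sort g).injective)
  have he (x y) : g (e x) < g (e y) ↔ mirrorRank r m x < mirrorRank r m y := hmono.lt_iff_lt
  have hmem (S : Finset (Fin m)) (hS : #S = 2 * p) :
      (∃ i, (mirrorLabel r S ∘ e.symm) i = false) ∧ (∃ i, (mirrorLabel r S ∘ e.symm) i = true) ∧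
        auc (mirrorLabel r S ∘ e.symm) g = (p : ℝ) / (q : ℝ) := by
    have hex (b : Bool) (h : 0 < #{x | mirrorLabel r S x = b}) :
        ∃ i, (mirrorLabel r S ∘ e.symm) i = b := by
      obtain ⟨x, hx⟩ := card_pos.1 h
      exact ⟨e x, by simpa using hx⟩
    refine ⟨hex _ ?_, hex _ ?_, ?_⟩
    · rw [card_mirrorLabel_false]
      omega
    · rw [card_mirrorLabel_true]
      omega
    · rw [auc_mirrorLabel e g he, hS, show m - 2 * p = q by omega,
        show r + 2 * (2 * p) = 2 * q by omega]
      have : (q : ℝ) ≠ 0 := by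
        norm_cast
        omega
      push_cast
      field_simp
  have hinj : Function.Injective fun S : powersetCard (2 * p) (univ : Finset (Fin m)) =>
      (⟨mirrorLabel r S.1 ∘ e.symm, hmem S.1 (mem_powersetCard.1 S.2).2⟩ :
        {y : Fin (4 * q) → Bool //
          (∃ i, y i = false) ∧ (∃ i, y i = true) ∧ auc y g = (p : ℝ) / (q : ℝ)}) := by
    intro S T h
    exact Subtype.ext (mirrorLabel_injective r m
      (e.symm.surjective.injective_comp_right (Subtype.ext_iff.1 h)))
  have hcard := Nat.card_le_card_of_injective _ hinj
  rw [Nat.card_eq_fintype_card, Fintype.card_coe, card_powersetCard, card_univ, Fintype.card_fin,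
    ← Nat.choose_symm_of_eq_add hm] at hcard
  have hq : (q : ℝ) ≠ 0 := by
    norm_cast
    omega
  calc (((q : ℝ) + 2 * (p : ℝ)) / (q : ℝ)) ^ q = (1 + ((2 * p : ℕ) : ℝ) / q) ^ q := by
        rw [add_div, div_self hq]
        push_cast
        rfl
    _ ≤ (m.choose q : ℝ) := one_add_div_pow_le_choose q (2 * p) le_rfl
    _ ≤ _ := by exact_mod_cast hcard
end

section
/- Let p, q be positive integers with 2p < q, set r = q − p (so q < 2r and r < q), let n = 4q, and let ŷ_1,…,ŷ_n be strictly increasing real-valued guesses (ŷ_1 < … < ŷ_n). Let (y_1,…,y_n) ∈ {0,1}^n be any labeling such that: (i) y_i = 0 for all i ∈ {2(3q−2r)+1,…,4q} (the last 2(2r−q) indices); (ii) the restriction of y to the first L = 2(3q−2r) indices is palindromic, i.e., y_t = y_{L+1−t} for all t ∈ {1,…,L}; and (iii) exactly 2q of these first L indices carry label 1 (so the labeling has n1 = 2q ones and n0 = 2q zeros). Then f(y_{1:n}, ŷ_{1:n}) = p/q; in particular, exactly 4q² − 4qr of the 4q² positive–negative pairs are correctly classified and 4qr are misclassified. -/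
open Finset

/-- Mirroring the first `L` indices of a labeling that is palindromic there exchanges correctly
ordered and wrongly ordered zero-one pairs, so exactly half of these pairs are correctly ordered. -/
theorem two_mul_card_lt_pairs_of_palindrome {n L : ℕ} (y : Fin n → Bool) (hL : L ≤ n)
    (hy : ∀ i j : Fin n, (i : ℕ) + (j : ℕ) = L - 1 → y i = y j) :
    2 * #{pr : Fin n × Fin n | ((pr.1 : ℕ) < L ∧ y pr.1 = false) ∧
        ((pr.2 : ℕ) < L ∧ y pr.2 = true) ∧ pr.1 < pr.2} =
      #{i : Fin n | (i : ℕ) < L ∧ y i = false} * #{i : Fin n | (i : ℕ) < L ∧ y i = true} := by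
  set A : Finset (Fin n × Fin n) := {pr | ((pr.1 : ℕ) < L ∧ y pr.1 = false) ∧
    ((pr.2 : ℕ) < L ∧ y pr.2 = true) ∧ pr.1 < pr.2} with hA
  set B : Finset (Fin n × Fin n) := {pr | ((pr.1 : ℕ) < L ∧ y pr.1 = false) ∧
    ((pr.2 : ℕ) < L ∧ y pr.2 = true) ∧ pr.2 < pr.1} with hB
  let m : Fin n → Fin n := fun i => if h : (i : ℕ) < L then ⟨L - 1 - i, by omega⟩ else i
  have hm : ∀ i : Fin n, (i : ℕ) < L → (m i : ℕ) = L - 1 - i := fun i hi => by simp [m, hi]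
  have hmm : ∀ i : Fin n, (i : ℕ) < L → m (m i) = i := fun i hi => by
    ext
    rw [hm _ (by rw [hm i hi]; omega), hm i hi]
    omega
  have hym : ∀ i : Fin n, (i : ℕ) < L → y (m i) = y i := fun i hi =>
    hy _ _ (by rw [hm i hi]; omega)
  have hAB : #A = #B := by
    refine Finset.card_nbij' (fun pr => (m pr.1, m pr.2)) (fun pr => (m pr.1, m pr.2)) ?_ ?_ ?_ ?_
    · rintro ⟨i, j⟩ h
      simp only [hA, hB, coe_filter, mem_univ, true_and, Set.mem_ofPred_eq, Fin.lt_def] at h ⊢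
      obtain ⟨⟨hi, hyi⟩, ⟨hj, hyj⟩, hij⟩ := h
      rw [hym i hi, hym j hj, hm i hi, hm j hj]
      exact ⟨⟨by omega, hyi⟩, ⟨by omega, hyj⟩, by omega⟩
    · rintro ⟨i, j⟩ h
      simp only [hA, hB, coe_filter, mem_univ, true_and, Set.mem_ofPred_eq, Fin.lt_def] at h ⊢
      obtain ⟨⟨hi, hyi⟩, ⟨hj, hyj⟩, hij⟩ := h
      rw [hym i hi, hym j hj, hm i hi, hm j hj]
      exact ⟨⟨by omega, hyi⟩, ⟨by omega, hyj⟩, by omega⟩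
    · rintro ⟨i, j⟩ h
      simp only [hA, coe_filter, mem_univ, true_and, Set.mem_ofPred_eq] at h
      simp [hmm i h.1.1, hmm j h.2.1.1]
    · rintro ⟨i, j⟩ h
      simp only [hB, coe_filter, mem_univ, true_and, Set.mem_ofPred_eq] at h
      simp [hmm i h.1.1, hmm j h.2.1.1]
  have hdisj : Disjoint A B := by
    rw [Finset.disjoint_left]
    intro pr h h'
    simp only [hA, hB, mem_filter] at h h'
    exact lt_asymm h.2.2.2 h'.2.2.2
  rw [two_mul]
  nth_rw 2 [hAB]
  rw [← card_union_of_disjoint hdisj, ← card_product]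
  congr 1
  ext ⟨i, j⟩
  simp only [hA, hB, mem_union, mem_filter, mem_univ, true_and, mem_product]
  constructor
  · tauto
  · rintro ⟨hi, hj⟩
    rcases lt_trichotomy i j with h | rfl | h
    · tauto
    · simp [hi.2] at hj
    · tauto

/-- For injective guesses, every zero-one pair is either correctly classified or misclassified. -/
theorem card_correct_add_card_misclassified {n : ℕ} (y : Fin n → Bool) {g : Fin n → ℝ}
    (hg : Function.Injective g) :
    #{pr : Fin n × Fin n | y pr.1 = false ∧ y pr.2 = true ∧ g pr.1 < g pr.2} +
        #{pr : Fin n × Fin n | y pr.1 = false ∧ y pr.2 = true ∧ g pr.2 < g pr.1} =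
      #{i : Fin n | y i = false} * #{i : Fin n | y i = true} := by
  rw [← card_union_of_disjoint, ← card_product]
  · congr 1
    ext ⟨i, j⟩
    simp only [mem_union, mem_filter, mem_univ, true_and, mem_product]
    constructor
    · tauto
    · rintro ⟨hi, hj⟩
      have hne : g i ≠ g j := fun h => by simp [hg h, hj] at hi
      rcases hne.lt_or_gt with h | h <;> tauto
  · rw [Finset.disjoint_left]
    intro pr h h'
    simp only [mem_filter] at h h'
    exact lt_asymm h.2.2.2 h'.2.2.2

theorem auc_eq_card_div {n : ℕ} (y : Fin n → Bool) (g : Fin n → ℝ) :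
    auc y g =
      (#{pr : Fin n × Fin n | y pr.1 = false ∧ y pr.2 = true ∧ g pr.1 < g pr.2} : ℝ) /
        ((#{i : Fin n | y i = false} : ℝ) * (#{i : Fin n | y i = true} : ℝ)) := by
  rw [auc, ← sum_product', sum_boole]
  congr 3
  ext pr
  simp [and_assoc]

/-- Construction for `0 < p/q < 1/2`, with `r = q - p`: with `n = 4q` strictly increasing
guesses, any labeling whose last `2(2r-q)` entries are negative, whose first
`L = 2(3q-2r)` entries form a palindrome (indices `i, j` in the left band are mirror
images exactly when `i + j = 2(3q-2r) - 1`, 0-based), and which has exactly `2q`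
positive labels in that left band, achieves AUC exactly `p/q`; in particular exactly
`4q² - 4qr` of the `4q²` positive–negative pairs are correctly classified and `4qr`
are misclassified. -/
theorem stmt9 (p q : ℕ) (hp : 0 < p) (h2pq : 2 * p < q)
    (r : ℕ) (hr : r = q - p)
    (g : Fin (4 * q) → ℝ) (hg : StrictMono g)
    (y : Fin (4 * q) → Bool)
    (h1 : ∀ i : Fin (4 * q), 2 * (3 * q - 2 * r) ≤ (i : ℕ) → y i = false)
    (h2 : ∀ i j : Fin (4 * q),
      (i : ℕ) + (j : ℕ) = 2 * (3 * q - 2 * r) - 1 → y i = y j)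
    (h3 : (Finset.univ.filter fun i : Fin (4 * q) =>
        (i : ℕ) < 2 * (3 * q - 2 * r) ∧ y i = true).card = 2 * q) :
    auc y g = (p : ℝ) / (q : ℝ) ∧
      (Finset.univ.filter fun pr : Fin (4 * q) × Fin (4 * q) =>
          y pr.1 = false ∧ y pr.2 = true ∧ g pr.1 < g pr.2).card = 4 * q * q - 4 * q * r ∧
      (Finset.univ.filter fun pr : Fin (4 * q) × Fin (4 * q) =>
          y pr.1 = false ∧ y pr.2 = true ∧ g pr.2 < g pr.1).card = 4 * q * r := by
  have hL : 2 * (3 * q - 2 * r) = 2 * q + 4 * p := by omega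
  rw [hL] at h1 h2 h3
  have hlt : ∀ j, y j = true → (j : ℕ) < 2 * q + 4 * p := fun j hj => by
    by_contra! h
    simp [h1 j h] at hj
  have hpos : #{j : Fin (4 * q) | y j = true} = 2 * q := by
    rw [← h3]
    congr 1
    ext j
    simpa using hlt j
  have hneg : #{i : Fin (4 * q) | y i = false} = 2 * q := by
    have h := card_filter_add_card_filter_not (s := univ) (fun i : Fin (4 * q) => y i = true)
    simp only [Bool.not_eq_true, card_univ, Fintype.card_fin] at h
    omega
  have hnegL : #{i : Fin (4 * q) | (i : ℕ) < 2 * q + 4 * p ∧ y i = false} = 4 * p := by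
    have h := card_filter_add_card_filter_not
      (s := {i : Fin (4 * q) | (i : ℕ) < 2 * q + 4 * p}) (fun i => y i = true)
    simp only [Bool.not_eq_true, filter_filter, Fin.card_filter_val_lt] at h
    omega
  have hcorrect : #{pr : Fin (4 * q) × Fin (4 * q) |
      y pr.1 = false ∧ y pr.2 = true ∧ g pr.1 < g pr.2} = 4 * q * p := by
    have h := two_mul_card_lt_pairs_of_palindrome y (by omega) h2
    rw [hnegL, h3] at h
    have heq : ({pr | y pr.1 = false ∧ y pr.2 = true ∧ g pr.1 < g pr.2} :
        Finset (Fin (4 * q) × Fin (4 * q))) =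
        ({pr | ((pr.1 : ℕ) < 2 * q + 4 * p ∧ y pr.1 = false) ∧
          ((pr.2 : ℕ) < 2 * q + 4 * p ∧ y pr.2 = true) ∧ pr.1 < pr.2} :
        Finset (Fin (4 * q) × Fin (4 * q))) := by
      ext ⟨i, j⟩
      simp only [mem_filter, mem_univ, true_and, hg.lt_iff_lt]
      constructor
      · rintro ⟨hi, hj, hij⟩
        exact ⟨⟨lt_trans hij (hlt j hj), hi⟩, ⟨hlt j hj, hj⟩, hij⟩
      · tauto
    rw [heq]
    linarith
  have htotal := card_correct_add_card_misclassified y hg.injective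
  rw [hcorrect, hneg, hpos] at htotal
  have hq : q = p + r := by omega
  refine ⟨?_, ?_, ?_⟩
  · rw [auc_eq_card_div, hcorrect, hneg, hpos]
    have : (q : ℝ) ≠ 0 := by
      have : q ≠ 0 := by omega
      exact_mod_cast this
    push_cast
    field_simp
    ring
  · rw [hcorrect, ← Nat.mul_sub]
    congr 1
    omega
  · have : 2 * q * (2 * q) = 4 * q * p + 4 * q * r := by
      rw [← mul_add, ← hq]
      ring
    omega
end
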